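/- Let 0 < α < β ≤ 1/2 and 0 < ε < β − α, and consider the Markov chain on the three-state space {1,2,3} with transition matrix P given by rows (0, 1, 0), (ε/(1−α−ε), 1 − (α+ε)/(1−α−ε), α/(1−α−ε)) and (0, 1, 0). Then this chain is irreducible with stationary distribution π = (ε, 1−α−ε, α), and it satisfies T(β) = 1 and T(α) = 1/α. -/

import Mathlib

/-- `P` is a row-stochastic transition matrix on the finite state space `Ω`. -/
def IsTransitionMatrix {Ω : Type*} [Fintype Ω] (P : Matrix Ω Ω ℝ) : Prop :=
  (∀ x y, 0 ≤ P x y) ∧ ∀ x, ∑ y, P x y = 1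

/-- The chain is irreducible: any state can reach any other state. -/
def IsIrreducibleChain {Ω : Type*} [Fintype Ω] [DecidableEq Ω] (P : Matrix Ω Ω ℝ) : Prop :=
  ∀ x y, ∃ n : ℕ, 0 < (P ^ n) x y

/-- `π` is a stationary distribution for `P`. -/
def IsStationaryDist {Ω : Type*} [Fintype Ω] (P : Matrix Ω Ω ℝ) (π : Ω → ℝ) : Prop :=
  (∀ x, 0 ≤ π x) ∧ (∑ x, π x = 1) ∧ ∀ y, ∑ x, π x * P x y = π y

/-- The expected hitting time `E_x[τ_A] = ∑_{t=0}^∞ ∑_{y ∉ A} Qᵗ(x,y)`, where `Q` is `P`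
with rows and columns indexed by `A` replaced by zero. -/
noncomputable def hitTime {Ω : Type*} [Fintype Ω] [DecidableEq Ω]
    (P : Matrix Ω Ω ℝ) (A : Finset Ω) (x : Ω) : ℝ :=
  ∑' t : ℕ, ∑ y ∈ Aᶜ, (((Matrix.of fun u v => if u ∈ A ∨ v ∈ A then (0:ℝ) else P u v)) ^ t) x y

/-- `T(α)`: the maximum expected hitting time of a set of stationary measure at least `α`. -/
noncomputable def Tfun {Ω : Type*} [Fintype Ω] [DecidableEq Ω]
    (P : Matrix Ω Ω ℝ) (π : Ω → ℝ) (α : ℝ) : ℝ :=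
  sSup {r | ∃ (x : Ω) (A : Finset Ω), α ≤ ∑ a ∈ A, π a ∧ r = hitTime P A x}

/-- `d⁺(A,B) = max_{x ∈ A} E_x[τ_B]`. -/
noncomputable def dplus {Ω : Type*} [Fintype Ω] [DecidableEq Ω]
    (P : Matrix Ω Ω ℝ) (A B : Finset Ω) : ℝ :=
  sSup {r | ∃ x ∈ A, r = hitTime P B x}

/-- `d⁻(A,B) = min_{x ∈ A} E_x[τ_B]`. -/
noncomputable def dminus {Ω : Type*} [Fintype Ω] [DecidableEq Ω]
    (P : Matrix Ω Ω ℝ) (A B : Finset Ω) : ℝ :=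
  sInf {r | ∃ x ∈ A, r = hitTime P B x}

open Filter Topology in
lemma hitTime_eq_of_harmonic {Ω : Type*} [Fintype Ω] [DecidableEq Ω]
    (P : Matrix Ω Ω ℝ) (hP : ∀ x y, 0 ≤ P x y) (A : Finset Ω) (h : Ω → ℝ)
    (h0 : ∀ x, 0 ≤ h x) (hA : ∀ x ∈ A, h x = 0)
    (hh : ∀ x, x ∉ A → h x = 1 + ∑ y, P x y * h y) (x : Ω) :
    hitTime P A x = h x := by
  classical
  unfold hitTime
  set Q : Matrix Ω Ω ℝ := Matrix.of fun u v => if u ∈ A ∨ v ∈ A then (0:ℝ) else P u v with hQ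
  have hQ0 : ∀ (t : ℕ) u v, 0 ≤ (Q ^ t) u v := by
    intro t
    induction t with
    | zero => intro u v; simp only [pow_zero, Matrix.one_apply]; split_ifs <;> norm_num
    | succ t ih =>
      intro u v
      rw [pow_succ, Matrix.mul_apply]
      refine Finset.sum_nonneg fun w _ => mul_nonneg (ih u w) ?_
      simp only [hQ, Matrix.of_apply]
      split_ifs
      · exact le_rfl
      · exact hP _ _
  -- one-step equation
  have hstep : ∀ u, ∑ v, Q u v * h v = h u - (if u ∈ Aᶜ then 1 else 0) := by
    intro u
    by_cases hu : u ∈ A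
    · simp [hQ, hu, hA u hu]
    · rw [hh u hu]
      have : ∀ v, Q u v * h v = P u v * h v := by
        intro v
        by_cases hv : v ∈ A
        · simp [hA v hv]
        · simp [hQ, hu, hv]
      simp [this, hu]
  set g : ℕ → ℝ := fun t => ∑ y, (Q ^ t) x y * h y with hg
  set f : ℕ → ℝ := fun t => ∑ y ∈ Aᶜ, (Q ^ t) x y with hf
  have hg0 : ∀ t, 0 ≤ g t := fun t => Finset.sum_nonneg fun y _ => mul_nonneg (hQ0 t x y) (h0 y)
  have hf0 : ∀ t, 0 ≤ f t := fun t => Finset.sum_nonneg fun y _ => hQ0 t x y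
  have hfg : ∀ t, g (t+1) = g t - f t := by
    intro t
    have e1 : g (t+1) = ∑ u, (Q ^ t) x u * ∑ v, Q u v * h v := by
      simp only [hg, pow_succ, Matrix.mul_apply, Finset.sum_mul, Finset.mul_sum]
      rw [Finset.sum_comm]
      simp only [mul_assoc]
    rw [e1]
    simp only [hstep, mul_sub, Finset.sum_sub_distrib, hg, hf]
    congr 1
    simp only [mul_ite, mul_one, mul_zero, Finset.sum_ite_mem, Finset.univ_inter]
  have hpart : ∀ n, ∑ t ∈ Finset.range n, f t = h x - g n := by
    intro n
    induction n with
    | zero => simp [hg, Matrix.one_apply]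
    | succ n ih => rw [Finset.sum_range_succ, ih, hfg]; ring
  have hsum : Summable f := summable_of_sum_range_le hf0 (c := h x) (fun n => by
    rw [hpart]; linarith [hg0 n])
  have hft : Tendsto f atTop (𝓝 0) := hsum.tendsto_atTop_zero
  have hgle : ∀ t, g t ≤ (∑ y, h y) * f t := by
    intro t
    simp only [hg, hf]
    rw [Finset.mul_sum]
    have : ∑ y, (Q ^ t) x y * h y = ∑ y ∈ Aᶜ, (Q ^ t) x y * h y := by
      symm
      apply Finset.sum_subset (Finset.subset_univ _)
      intro y _ hy
      rw [hA y (by simpa using hy), mul_zero]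
    rw [this]
    refine Finset.sum_le_sum fun y _ => ?_
    rw [mul_comm]
    exact mul_le_mul_of_nonneg_right
      (Finset.single_le_sum (fun i _ => h0 i) (Finset.mem_univ y)) (hQ0 t x y)
  have hgt : Tendsto g atTop (𝓝 0) := by
    refine squeeze_zero hg0 hgle ?_
    simpa using hft.const_mul (∑ y, h y)
  have : HasSum f (h x) := by
    rw [hasSum_iff_tendsto_nat_of_nonneg hf0]
    simp only [hpart]
    simpa using hgt.const_sub (h x)
  exact this.tsum_eq

lemma finset_fin_three : ∀ A : Finset (Fin 3), A = ∅ ∨ A = {0} ∨ A = {2} ∨ A = {0,2} ∨ A = {1} ∨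
    A = {0,1} ∨ A = {1,2} ∨ A = {0,1,2} := by decide

/-- For `0 < α < β ≤ 1/2` and `0 < ε < β − α`, the three-state chain with
transition matrix rows `(0, 1, 0)`, `(ε/(1−α−ε), 1 − (α+ε)/(1−α−ε), α/(1−α−ε))` and
`(0, 1, 0)` is irreducible with stationary distribution `(ε, 1−α−ε, α)`, and it satisfies
`T(β) = 1` and `T(α) = 1/α`. -/
theorem three_state_example (α β ε : ℝ) (hα : 0 < α) (hαβ : α < β) (hβ : β ≤ 1/2)
    (hε0 : 0 < ε) (hε : ε < β - α) :
    IsTransitionMatrix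
        !![0, 1, 0;
           ε/(1-α-ε), 1 - (α+ε)/(1-α-ε), α/(1-α-ε);
           0, 1, 0] ∧
    IsIrreducibleChain
        !![0, 1, 0;
           ε/(1-α-ε), 1 - (α+ε)/(1-α-ε), α/(1-α-ε);
           0, 1, 0] ∧
    IsStationaryDist
        !![0, 1, 0;
           ε/(1-α-ε), 1 - (α+ε)/(1-α-ε), α/(1-α-ε);
           0, 1, 0] ![ε, 1-α-ε, α] ∧
    Tfun !![0, 1, 0;
            ε/(1-α-ε), 1 - (α+ε)/(1-α-ε), α/(1-α-ε);
            0, 1, 0] ![ε, 1-α-ε, α] β = 1 ∧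
    Tfun !![0, 1, 0;
            ε/(1-α-ε), 1 - (α+ε)/(1-α-ε), α/(1-α-ε);
            0, 1, 0] ![ε, 1-α-ε, α] α = 1/α := by
  have hm : 0 < 1 - α - ε := by linarith
  have hm2 : α + ε < 1 - α - ε := by linarith
  have hTM : IsTransitionMatrix
        !![0, 1, 0;
           ε/(1-α-ε), 1 - (α+ε)/(1-α-ε), α/(1-α-ε);
           0, 1, 0] := by
    have h1 : 0 ≤ 1 - (α+ε)/(1-α-ε) := by
      rw [sub_nonneg, div_le_one hm]; exact hm2.le
    have h2 : 0 ≤ ε/(1-α-ε) := by positivity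
    have h3 : 0 ≤ α/(1-α-ε) := by positivity
    constructor
    · intro x y
      fin_cases x <;> fin_cases y <;> simp <;> first | exact h2 | exact h3 | simpa using h1
    · intro x
      fin_cases x <;> simp [Fin.sum_univ_three]
      field_simp
      ring
  refine ⟨hTM, ?_, ?_, ?_⟩
  · have h2 : 0 < ε/(1-α-ε) := by positivity
    have h3 : 0 < α/(1-α-ε) := by positivity
    intro x y
    fin_cases x <;> fin_cases y
    · exact ⟨0, by simp⟩
    · exact ⟨1, by simp⟩
    · exact ⟨2, by simpa [pow_two, Matrix.mul_apply, Fin.sum_univ_three] using h3⟩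
    · exact ⟨1, by simpa using h2⟩
    · exact ⟨0, by simp⟩
    · exact ⟨1, by simpa using h3⟩
    · exact ⟨2, by simpa [pow_two, Matrix.mul_apply, Fin.sum_univ_three] using h2⟩
    · exact ⟨1, by simp⟩
    · exact ⟨0, by simp⟩
  · refine ⟨?_, ?_, ?_⟩
    · intro x; fin_cases x <;> simp <;> linarith
    · simp [Fin.sum_univ_three]
    · intro y
      fin_cases y <;> simp [Fin.sum_univ_three] <;> field_simp
      ring
  have key := hitTime_eq_of_harmonic _ hTM.1
  have k1 := key {1} ![1,0,1] (by intro x; fin_cases x <;> simp)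
    (by intro x; fin_cases x <;> simp)
    (by intro x; fin_cases x <;> simp [Fin.sum_univ_three])
  have k01 := key {0,1} ![0,0,1] (by intro x; fin_cases x <;> simp)
    (by intro x; fin_cases x <;> simp)
    (by intro x; fin_cases x <;> simp [Fin.sum_univ_three])
  have k12 := key {1,2} ![1,0,0] (by intro x; fin_cases x <;> simp)
    (by intro x; fin_cases x <;> simp)
    (by intro x; fin_cases x <;> simp [Fin.sum_univ_three])
  have k012 := key {0,1,2} ![0,0,0] (by intro x; fin_cases x <;> simp)
    (by intro x; fin_cases x <;> simp)
    (by intro x; fin_cases x <;> simp [Fin.sum_univ_three])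
  have n2 : 0 ≤ (1-α)/α := div_nonneg (by linarith) hα.le
  have n0 : 0 ≤ (1-ε)/ε := div_nonneg (by linarith) hε0.le
  have n02 : 0 ≤ (1-α-ε)/(α+ε) := div_nonneg hm.le (by linarith)
  have p2 : 0 ≤ 1/α := by positivity
  have p0 : 0 ≤ 1/ε := by positivity
  have k2 := key {2} ![1/α,(1-α)/α,0]
    (by intro x; fin_cases x <;> first | exact p2 | exact n2 | simp)
    (by intro x; fin_cases x <;> simp)
    (by
      intro x
      fin_cases x <;> simp [Fin.sum_univ_three] <;> field_simp <;> ring)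
  have k0 := key {0} ![0,(1-ε)/ε,1/ε]
    (by intro x; fin_cases x <;> first | exact p0 | exact n0 | simp)
    (by intro x; fin_cases x <;> simp)
    (by
      intro x
      fin_cases x <;> simp [Fin.sum_univ_three] <;> field_simp <;> ring)
  have k02 := key {0,2} ![0,(1-α-ε)/(α+ε),0]
    (by intro x; fin_cases x <;> first | exact n02 | simp)
    (by intro x; fin_cases x <;> simp)
    (by
      intro x
      have : α + ε ≠ 0 := by positivity
      fin_cases x <;> simp [Fin.sum_univ_three] <;> field_simp <;> ring)
  have one_le : 1 ≤ 1/α := by rw [le_div_iff₀ hα]; linarith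
  constructor
  · refine IsGreatest.csSup_eq ⟨⟨0, {1}, ?_, ?_⟩, ?_⟩
    · simp; linarith
    · rw [k1]; simp
    · rintro r ⟨x, A, hA, rfl⟩
      rcases finset_fin_three A with rfl | rfl | rfl | rfl | rfl | rfl | rfl | rfl
      · simp at hA; linarith
      · simp at hA; linarith
      · simp at hA; linarith
      · simp at hA; linarith
      · rw [k1]; fin_cases x <;> simp
      · rw [k01]; fin_cases x <;> simp
      · rw [k12]; fin_cases x <;> simp
      · rw [k012]; fin_cases x <;> simp
  · refine IsGreatest.csSup_eq ⟨⟨0, {2}, ?_, ?_⟩, ?_⟩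
    · simp
    · rw [k2]; simp
    · rintro r ⟨x, A, hA, rfl⟩
      rcases finset_fin_three A with rfl | rfl | rfl | rfl | rfl | rfl | rfl | rfl
      · simp at hA; linarith
      · simp at hA
        have q : 1/ε ≤ 1/α := one_div_le_one_div_of_le hα hA
        have q2 : (1-ε)/ε ≤ 1/α := le_trans (by gcongr; linarith) q
        rw [k0]; fin_cases x
        · exact p2
        · exact q2
        · exact q
      · rw [k2]; fin_cases x
        · exact le_rfl
        · change (1-α)/α ≤ 1/α
          gcongr; linarith
        · exact p2
      · rw [k02]; fin_cases x
        · exact p2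
        · change (1-α-ε)/(α+ε) ≤ 1/α
          exact div_le_div₀ (by norm_num) (by linarith) hα (by linarith)
        · exact p2
      · rw [k1]; fin_cases x <;> first | exact one_le | exact p2
      · rw [k01]; fin_cases x <;> first | exact one_le | exact p2
      · rw [k12]; fin_cases x <;> first | exact one_le | exact p2
      · rw [k012]; fin_cases x <;> exact p2
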